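/- Let s ∈ (0,1), p ∈ [2,∞), N ≥ 2 an integer with sp < N, and let f : ℝ → ℝ be continuous with f(t) = 0 for t ≤ 0, satisfying (f1), (f2), (f3)_gs and (f5). Suppose (u_n) ⊂ M with T(u_n) → D, and (λ_n) ⊂ ℝ satisfies sup{ |T'(u_n)·φ − λ_n J'(u_n)·φ| : φ ∈ W^{s,p}(ℝ^N), ‖φ‖_{s,p} ≤ 1 } → 0. Then 0 ≤ liminf_{n→∞} λ_n ≤ limsup_{n→∞} λ_n ≤ D. -/

import Mathlib

open MeasureTheory Real Filter Topology Set

noncomputable section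

/-- `ℝ^N` -/
abbrev RN (N : ℕ) := EuclideanSpace ℝ (Fin N)

/-- The `p`-th power of the Gagliardo seminorm `[u]_{s,p}`, as an extended
nonnegative real number:
`[u]_{s,p}^p = ∫∫ |u x - u y|^p / |x-y|^(N+sp) dx dy`. -/
def gagE (N : ℕ) (s p : ℝ) (u : RN N → ℝ) : ENNReal :=
  ∫⁻ x : RN N, ∫⁻ y : RN N,
    ENNReal.ofReal (|u x - u y| ^ p / ‖x - y‖ ^ ((N : ℝ) + s * p))

/-- The `p`-th power of the Gagliardo seminorm, as a real number. -/
def gagP (N : ℕ) (s p : ℝ) (u : RN N → ℝ) : ℝ := (gagE N s p u).toReal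

/-- Membership in the fractional Sobolev space `W^{s,p}(ℝ^N)`:
`u ∈ L^p(ℝ^N)` and `[u]_{s,p} < ∞`. -/
def memW (N : ℕ) (s p : ℝ) (u : RN N → ℝ) : Prop :=
  AEStronglyMeasurable u volume ∧ Integrable (fun x => |u x| ^ p) volume ∧
    gagE N s p u < ⊤

/-- `‖u‖_{s,p}^p = [u]_{s,p}^p + ‖u‖_{L^p}^p`. -/
def sobNormP (N : ℕ) (s p : ℝ) (u : RN N → ℝ) : ℝ :=
  gagP N s p u + ∫ x : RN N, |u x| ^ p

/-- The norm `‖u‖_{s,p} = ([u]_{s,p}^p + ‖u‖_{L^p}^p)^(1/p)`. -/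
def sobNorm (N : ℕ) (s p : ℝ) (u : RN N → ℝ) : ℝ := (sobNormP N s p u) ^ (1 / p)

/-- `u` is radially symmetric: `u x` depends only on `‖x‖`. -/
def radial (N : ℕ) (u : RN N → ℝ) : Prop := ∀ x y : RN N, ‖x‖ = ‖y‖ → u x = u y

/-- Membership in `W_r^{s,p}(ℝ^N)`, the subspace of radial functions. -/
def memWr (N : ℕ) (s p : ℝ) (u : RN N → ℝ) : Prop := memW N s p u ∧ radial N u

/-- The primitive `F(t) = ∫_0^t f(τ) dτ`. -/
def primF (f : ℝ → ℝ) (t : ℝ) : ℝ := ∫ τ in (0:ℝ)..t, f τ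

/-- The energy functional `I(u) = (1/p)‖u‖_{s,p}^p - ∫ F(u)`. -/
def ene (N : ℕ) (s p : ℝ) (f : ℝ → ℝ) (u : RN N → ℝ) : ℝ :=
  (1 / p) * sobNormP N s p u - ∫ x : RN N, primF f (u x)

/-- The pairing `⟨(-Δ_p)^s u, φ⟩`. -/
def pairA (N : ℕ) (s p : ℝ) (u φ : RN N → ℝ) : ℝ :=
  ∫ x : RN N, ∫ y : RN N,
    |u x - u y| ^ (p - 2) * (u x - u y) * (φ x - φ y) / ‖x - y‖ ^ ((N : ℝ) + s * p)

/-- The derivative `I'(u)·φ`. -/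
def enePrime (N : ℕ) (s p : ℝ) (f : ℝ → ℝ) (u φ : RN N → ℝ) : ℝ :=
  pairA N s p u φ + (∫ x : RN N, |u x| ^ (p - 2) * u x * φ x) -
    ∫ x : RN N, f (u x) * φ x

/-- `u` is a weak solution of `(-Δ_p)^s u = -|u|^{p-2}u + f(u)` in `ℝ^N`:
for every `φ ∈ W^{s,p}(ℝ^N)`,
`⟨(-Δ_p)^s u, φ⟩ + ∫ |u|^{p-2} u φ = ∫ f(u) φ`. -/
def weakSol (N : ℕ) (s p : ℝ) (f : ℝ → ℝ) (u : RN N → ℝ) : Prop :=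
  ∀ φ : RN N → ℝ, memW N s p φ →
    pairA N s p u φ + (∫ x : RN N, |u x| ^ (p - 2) * u x * φ x) =
      ∫ x : RN N, f (u x) * φ x

/-- Hypothesis (f1): `lim_{t→0} f(t)/(|t|^{p-2} t) = 0`. -/
def hypF1 (p : ℝ) (f : ℝ → ℝ) : Prop :=
  Tendsto (fun t => f t / (|t| ^ (p - 2) * t)) (𝓝[≠] (0:ℝ)) (𝓝 0)

/-- Hypothesis (f2): `limsup_{t→+∞} f(t)/t^{p_s^*-1} ≤ 1`, where
`p_s^* = pN/(N-sp)`. -/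
def hypF2 (N : ℕ) (s p : ℝ) (f : ℝ → ℝ) : Prop :=
  Filter.limsup (fun t : ℝ => ((f t / t ^ (p * N / ((N : ℝ) - s * p) - 1) : ℝ) : EReal))
    atTop ≤ 1

/-- Hypothesis (f3): there are `μ > 0` and `q ∈ (p,∞)` with `f(t) ≥ μ t^{q-1}`
for all `t ≥ 0`. -/
def hypF3 (p : ℝ) (f : ℝ → ℝ) : Prop :=
  ∃ μ > (0:ℝ), ∃ q : ℝ, p < q ∧ ∀ t ≥ (0:ℝ), μ * t ^ (q - 1) ≤ f t

/-- Hypothesis (f4) with threshold `α₀`: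
`lim_{t→+∞} f(t)/e^{α t^{N/(N-s)}} = 0` for `α > α₀` and `= +∞` for `0 < α < α₀`. -/
def hypF4 (N : ℕ) (s : ℝ) (f : ℝ → ℝ) (α₀ : ℝ) : Prop :=
  (∀ α > α₀, Tendsto (fun t => f t / Real.exp (α * t ^ ((N : ℝ) / ((N : ℝ) - s))))
      atTop (𝓝 0)) ∧
  (∀ α : ℝ, 0 < α → α < α₀ →
    Tendsto (fun t => f t / Real.exp (α * t ^ ((N : ℝ) / ((N : ℝ) - s)))) atTop atTop)

/-- `Q_α(t) = e^{α|t|^{p'}} - ∑_{0 ≤ j < p} (α|t|^{p'})^j / j!`, with `p' = p/(p-1)`. -/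
def Qfun (p α t : ℝ) : ℝ :=
  Real.exp (α * |t| ^ (p / (p - 1))) -
    ∑ j ∈ Finset.range ⌈p⌉₊, (α * |t| ^ (p / (p - 1))) ^ j / (Nat.factorial j : ℝ)

/-- `G(t) = F(t) - |t|^p/p`, the primitive of `g(t) = -|t|^{p-2}t + f(t)`. -/
def Gfun (p : ℝ) (f : ℝ → ℝ) (t : ℝ) : ℝ := primF f t - |t| ^ p / p

/-- The best constant `C_q` of the embedding `W^{s,p}(ℝ^N) ↪ L^q(ℝ^N)`:
`C_q = inf { ([u]_{s,p}^p + ‖u‖_{L^p}^p) / ‖u‖_{L^q}^p : u ≠ 0 }`. -/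
def CqConst (N : ℕ) (s p q : ℝ) : ℝ :=
  sInf {r : ℝ | ∃ u : RN N → ℝ, memW N s p u ∧ u ≠ 0 ∧
    r = sobNormP N s p u / (∫ x : RN N, |u x| ^ q) ^ (p / q)}

/-- The best fractional Sobolev constant
`S = inf { [u]_{s,p}^p / ‖u‖_{L^{p_s^*}}^p : u ∈ D^{s,p}(ℝ^N), u ≠ 0 }`. -/
def Sconst (N : ℕ) (s p : ℝ) : ℝ :=
  sInf {r : ℝ | ∃ u : RN N → ℝ,
    Integrable (fun x => |u x| ^ (p * N / ((N : ℝ) - s * p))) volume ∧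
    AEStronglyMeasurable u volume ∧ gagE N s p u < ⊤ ∧ u ≠ 0 ∧
    r = gagP N s p u /
      (∫ x : RN N, |u x| ^ (p * N / ((N : ℝ) - s * p))) ^ (p / (p * N / ((N : ℝ) - s * p)))}

/-- The constant `μ*` in hypothesis `(f3)_gs` when `sp < N`. -/
def muStarSub (N : ℕ) (s p q : ℝ) : ℝ :=
  ((p : ℝ) ^ ((s * p - N) / (s * p)) * Sconst N s p ^ (-(N : ℝ) / (s * p)) *
      ((N : ℝ) / s) *
      (p * N / ((N : ℝ) - s * p)) ^ (((N : ℝ) - s * p) / (s * p))) ^ ((q - p) / p) *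
    ((q - p) / (p * q)) ^ ((q - p) / p) * CqConst N s p q ^ (q / p)

/-- The constant `μ*` in hypothesis `(f3)_gs` when `sp = N`. -/
def muStarEq (N : ℕ) (s p q : ℝ) : ℝ :=
  ((q - p) / (p * q)) ^ ((q - p) / p) * CqConst N s p q ^ (q / p)

/-- Hypothesis (f5): `f(t)t - pF(t) ≥ 0` for `t > 0`, and `F ≥ 0`. -/
def hypF5 (p : ℝ) (f : ℝ → ℝ) : Prop :=
  (∀ t > (0:ℝ), 0 ≤ f t * t - p * primF f t) ∧ ∀ t : ℝ, 0 ≤ primF f t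

/-- The ground state level `m = inf { I(v) : v ∈ W^{s,p}(ℝ^N) \ {0}, I'(v) = 0 }`. -/
def gsLevel (N : ℕ) (s p : ℝ) (f : ℝ → ℝ) : ℝ :=
  sInf {c : ℝ | ∃ v : RN N → ℝ, memW N s p v ∧ v ≠ 0 ∧ weakSol N s p f v ∧
    c = ene N s p f v}

/-- Continuity of a path `γ : [0,1] → W^{s,p}(ℝ^N)` with respect to `‖·‖_{s,p}`. -/
def pathCont (N : ℕ) (s p : ℝ) (γ : ℝ → RN N → ℝ) : Prop :=
  ∀ t ∈ Set.Icc (0:ℝ) 1, ∀ ε > (0:ℝ), ∃ δ > (0:ℝ), ∀ t' ∈ Set.Icc (0:ℝ) 1,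
    |t - t'| < δ → sobNorm N s p (fun x => γ t x - γ t' x) < ε

/-- The mountain pass level `b = inf_{γ ∈ Γ} max_{t ∈ [0,1]} I(γ(t))`, where
`Γ = { γ : [0,1] → W^{s,p}(ℝ^N) continuous : γ(0) = 0, I(γ(1)) < 0 }`. -/
def mpLevel (N : ℕ) (s p : ℝ) (f : ℝ → ℝ) : ℝ :=
  sInf {c : ℝ | ∃ γ : ℝ → RN N → ℝ, (∀ t ∈ Set.Icc (0:ℝ) 1, memW N s p (γ t)) ∧
    pathCont N s p γ ∧ γ 0 = 0 ∧ ene N s p f (γ 1) < 0 ∧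
    c = sSup ((fun t => ene N s p f (γ t)) '' Set.Icc (0:ℝ) 1)}

/-- The Pohožaev set
`P = { u ∈ W^{s,p}(ℝ^N) \ {0} : ((N-sp)/p)[u]_{s,p}^p = N ∫ G(u) }`. -/
def pohSet (N : ℕ) (s p : ℝ) (f : ℝ → ℝ) : Set (RN N → ℝ) :=
  {u | memW N s p u ∧ u ≠ 0 ∧
    (((N : ℝ) - s * p) / p) * gagP N s p u = N * ∫ x : RN N, Gfun p f (u x)}

/-- `p̃ = inf { I(u) : u ∈ P }`. -/
def pohLevel (N : ℕ) (s p : ℝ) (f : ℝ → ℝ) : ℝ :=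
  sInf {c : ℝ | ∃ u ∈ pohSet N s p f, c = ene N s p f u}

/-- The constraint set `M = { u ∈ W^{s,p}(ℝ^N) \ {0} : ∫ G(u) = 1 }`. -/
def Mset (N : ℕ) (s p : ℝ) (f : ℝ → ℝ) : Set (RN N → ℝ) :=
  {u | memW N s p u ∧ u ≠ 0 ∧ (∫ x : RN N, Gfun p f (u x)) = 1}

/-- `D = inf { (1/p)[u]_{s,p}^p : u ∈ M }`. -/
def Dconst (N : ℕ) (s p : ℝ) (f : ℝ → ℝ) : ℝ :=
  sInf {c : ℝ | ∃ u ∈ Mset N s p f, c = (1 / p) * gagP N s p u}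

/-- `J'(u)·φ = ∫ (f(u) - |u|^{p-2}u) φ`. -/
def Jprime (N : ℕ) (s p : ℝ) (f : ℝ → ℝ) (u φ : RN N → ℝ) : ℝ :=
  ∫ x : RN N, (f (u x) - |u x| ^ (p - 2) * u x) * φ x

/-- `(u_j)` is a `(PS)_c` sequence in `W_r^{s,p}(ℝ^N)` for `I`: `I(u_j) → c` and
`sup { |I'(u_j)·φ| : φ ∈ W_r^{s,p}, ‖φ‖_{s,p} ≤ 1 } → 0`. -/
def PSseq (N : ℕ) (s p : ℝ) (f : ℝ → ℝ) (c : ℝ) (u : ℕ → RN N → ℝ) : Prop :=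
  (∀ j, memWr N s p (u j)) ∧
  Tendsto (fun j => ene N s p f (u j)) atTop (𝓝 c) ∧
  (∀ δ > (0:ℝ), ∀ᶠ j in atTop, ∀ φ : RN N → ℝ, memWr N s p φ →
    sobNorm N s p φ ≤ 1 → |enePrime N s p f (u j) φ| ≤ δ)

lemma aux_pointwise (N : ℕ) (hN : 2 ≤ N) (s p q : ℝ) (hs : 0 < s) (hp : 2 ≤ p)
    (hsp : s * p < N) (hq : q * (N - s * p) = p * N) :
    ∃ K : ℝ, 0 < K ∧ ∀ (v : RN N → ℝ) (A : ℝ), AEStronglyMeasurable v volume → (∀ x, 0 ≤ v x) →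
      0 < A → (∫⁻ x, ENNReal.ofReal (v x ^ q)) ≤ ENNReal.ofReal A → ∀ x,
      ENNReal.ofReal (v x ^ q) ≤ ENNReal.ofReal (K * A ^ (s * p / N)) *
        ∫⁻ y, ENNReal.ofReal (|v x - v y| ^ p / ‖x - y‖ ^ ((N : ℝ) + s * p)) := by
  have hNpos : (0:ℝ) < N := by positivity
  have : Nonempty (Fin N) := ⟨⟨0, by omega⟩⟩
  have hspp : 0 < s * p := by positivity
  have hq0 : 0 < q := by
    by_contra h
    push Not at h
    nlinarith [mul_pos (by linarith : (0:ℝ) < p) hNpos]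
  have hqe : p + q * (s * p / N) = q := by
    field_simp
    nlinarith
  obtain ⟨ω, hω, hvol⟩ : ∃ ω : ℝ, 0 < ω ∧ ∀ (x : RN N) (r : ℝ), 0 < r →
      volume (Metric.ball x r) = ENNReal.ofReal (ω * r ^ (N : ℝ)) := by
    refine ⟨(volume (Metric.ball (0 : RN N) 1)).toReal, ?_, ?_⟩
    · exact ENNReal.toReal_pos (Metric.measure_ball_pos _ _ one_pos).ne' measure_ball_lt_top.ne
    · intro x r hr
      rw [Measure.addHaar_ball _ _ hr.le, ENNReal.ofReal_mul ENNReal.toReal_nonneg,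
        ENNReal.ofReal_toReal measure_ball_lt_top.ne, mul_comm]
      simp
  refine ⟨2 ^ (p + 1) / ω * (2 ^ (q + 1) / ω) ^ (s * p / N), by positivity, ?_⟩
  intro v A hv hv0 hA hvA x
  rcases (hv0 x).eq_or_lt with h0 | ht
  · rw [← h0, Real.zero_rpow hq0.ne']; simp
  set t := v x with htdef
  set b : ℝ := 2 ^ (q + 1) / ω * A * (t ^ q)⁻¹ with hb
  have hbpos : 0 < b := by positivity
  set r : ℝ := b ^ (1 / (N : ℝ)) with hr
  have hrpos : 0 < r := by positivity
  have hrN : r ^ (N : ℝ) = b := by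
    rw [hr, ← Real.rpow_mul hbpos.le]; field_simp; simp
  have hE : volume {y | ENNReal.ofReal ((t / 2) ^ q) ≤ ENNReal.ofReal (v y ^ q)} ≤
      ENNReal.ofReal (ω * b / 2) := by
    have hm := mul_meas_ge_le_lintegral₀ (μ := (volume : Measure (RN N)))
      (f := fun y => ENNReal.ofReal (v y ^ q))
      ((hv.aemeasurable.pow_const q).ennreal_ofReal) (ENNReal.ofReal ((t / 2) ^ q))
    have h2 := hm.trans hvA
    have h3 : ENNReal.ofReal A = ENNReal.ofReal ((t / 2) ^ q) * ENNReal.ofReal (ω * b / 2) := by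
      rw [← ENNReal.ofReal_mul (by positivity)]
      congr 1
      rw [hb, Real.div_rpow ht.le (by norm_num), Real.rpow_add (by norm_num)]
      have : (0:ℝ) < t ^ q := by positivity
      have : (0:ℝ) < 2 ^ q := by positivity
      field_simp
      simp
    rw [h3] at h2
    exact (ENNReal.mul_le_mul_iff_right (by simp; positivity) ENNReal.ofReal_ne_top).1 h2
  set E := {y | ENNReal.ofReal ((t / 2) ^ q) ≤ ENNReal.ofReal (v y ^ q)} with hEdef
  have hBE : ENNReal.ofReal (ω * b / 2) ≤ volume (Metric.ball x r \ E) := by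
    refine le_trans ?_ le_measure_sdiff
    rw [hvol x r hrpos, hrN]
    refine le_trans ?_ (tsub_le_tsub_left hE _)
    rw [← ENNReal.ofReal_sub _ (by positivity)]
    apply ENNReal.ofReal_le_ofReal
    linarith
  set c : ℝ := (t / 2) ^ p / r ^ ((N : ℝ) + s * p) with hc
  have hcpos : 0 < c := by positivity
  have hm2 := mul_meas_ge_le_lintegral₀ (μ := (volume : Measure (RN N)))
      (f := fun y => ENNReal.ofReal (|t - v y| ^ p / ‖x - y‖ ^ ((N : ℝ) + s * p)))
      (by
        apply AEMeasurable.ennreal_ofReal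
        apply AEMeasurable.div
        · exact ((hv.aemeasurable.const_sub t).abs).pow_const p
        · exact (by fun_prop : Measurable fun y : RN N => ‖x - y‖ ^ ((N : ℝ) + s * p)).aemeasurable)
      (ENNReal.ofReal c)
  have hsub : Metric.ball x r \ E ⊆ {y | ENNReal.ofReal c ≤
      ENNReal.ofReal (|t - v y| ^ p / ‖x - y‖ ^ ((N : ℝ) + s * p))} := by
    rintro y ⟨hy1, hy2⟩
    simp only [hEdef, mem_ofPred_eq, not_le] at hy2
    have hlt : v y < t / 2 := by
      by_contra h
      push Not at h
      exact absurd hy2 (not_lt.2 (ENNReal.ofReal_le_ofReal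
        (Real.rpow_le_rpow (by positivity) h hq0.le)))
    have hne : x ≠ y := by
      rintro rfl
      linarith
    have hd : 0 < ‖x - y‖ := norm_pos_iff.2 (sub_ne_zero.2 hne)
    have hd2 : ‖x - y‖ ≤ r := by
      rw [← dist_eq_norm, dist_comm]; exact (Metric.mem_ball.1 hy1).le
    apply ENNReal.ofReal_le_ofReal
    have : t / 2 ≤ |t - v y| := le_trans (by linarith) (le_abs_self _)
    apply div_le_div₀ (by positivity) (Real.rpow_le_rpow (by positivity) this (by linarith))
      (by positivity) (Real.rpow_le_rpow hd.le hd2 (by positivity))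
  have h4 : ENNReal.ofReal c * ENNReal.ofReal (ω * b / 2) ≤ 
      ∫⁻ y, ENNReal.ofReal (|t - v y| ^ p / ‖x - y‖ ^ ((N : ℝ) + s * p)) :=
    le_trans (mul_le_mul_right (hBE.trans (measure_mono hsub)) _) hm2
  refine le_trans ?_ (mul_le_mul_right h4 _)
  rw [← ENNReal.ofReal_mul (by positivity), ← ENNReal.ofReal_mul (by positivity)]
  apply ENNReal.ofReal_le_ofReal
  apply le_of_eq
  have hrsp : r ^ ((N : ℝ) + s * p) = b * b ^ (s * p / N) := by
    rw [Real.rpow_add hrpos, hrN, hr, ← Real.rpow_mul hbpos.le]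
    congr 2
    field_simp
  have hbσ : b ^ (s * p / N) * t ^ (q * (s * p / N)) =
      (2 ^ (q + 1) / ω) ^ (s * p / N) * A ^ (s * p / N) := by
    rw [Real.rpow_mul ht.le, ← Real.mul_rpow (by positivity) (by positivity),
      ← Real.mul_rpow (by positivity) (by positivity)]
    congr 1
    rw [hb]
    field_simp
  have htq : t ^ q = t ^ p * t ^ (q * (s * p / N)) := by
    rw [← Real.rpow_add ht, hqe]
  rw [hc, hrsp, htq, Real.div_rpow ht.le (by norm_num), Real.rpow_add (by norm_num) p 1,
    Real.rpow_one]
  have e1 : 2 ^ p * 2 / ω * (2 ^ (q + 1) / ω) ^ (s * p / N) * A ^ (s * p / N) =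
    2 ^ p * 2 / ω * (b ^ (s * p / N) * t ^ (q * (s * p / N))) := by rw [hbσ]; ring
  rw [e1]
  have : 0 < b ^ (s * p / N) := by positivity
  have : (0:ℝ) < 2 ^ p := by positivity
  field_simp

lemma aux_gag_meas (N : ℕ) (s p : ℝ) (u : RN N → ℝ) (hu : AEStronglyMeasurable u volume) :
    AEMeasurable (fun z : RN N × RN N =>
      ENNReal.ofReal (|u z.1 - u z.2| ^ p / ‖z.1 - z.2‖ ^ ((N : ℝ) + s * p)))
      (volume.prod volume) := by
  apply AEMeasurable.ennreal_ofReal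
  apply AEMeasurable.div
  · have h1 : AEMeasurable (fun z : RN N × RN N => u z.1) (volume.prod volume) :=
      hu.comp_fst.aemeasurable
    have h2 : AEMeasurable (fun z : RN N × RN N => u z.2) (volume.prod volume) :=
      hu.comp_snd.aemeasurable
    exact ((h1.sub h2).abs).pow_const p
  · exact (by fun_prop : Measurable fun z : RN N × RN N =>
      ‖z.1 - z.2‖ ^ ((N : ℝ) + s * p)).aemeasurable

lemma aux_sob (N : ℕ) (hN : 2 ≤ N) (s p q : ℝ) (hs : 0 < s) (hp : 2 ≤ p)
    (hsp : s * p < N) (hq : q * (N - s * p) = p * N) :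
    ∃ K : ℝ, 0 < K ∧ ∀ (u : RN N → ℝ), memW N s p u →
      Integrable (fun x => |u x| ^ q) volume ∧
      (∫ x, |u x| ^ q) ≤ (K * gagP N s p u) ^ ((N : ℝ) / (N - s * p)) := by
  obtain ⟨K, hK, hpt⟩ := aux_pointwise N hN s p q hs hp hsp hq
  refine ⟨K, hK, ?_⟩
  rintro u ⟨hum, hup, hug⟩
  have hNpos : (0:ℝ) < N := by positivity
  have hspp : 0 < s * p := by positivity
  have hd : 0 < (N : ℝ) - s * p := by linarith
  have hqp : p < q := by
    by_contra h
    push Not at h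
    nlinarith [mul_pos hspp (by linarith : (0:ℝ) < p), mul_le_mul_of_nonneg_right h hd.le]
  have hq0 : 0 < q := by linarith
  set Gr := gagP N s p u with hGr
  have hGr0 : 0 ≤ Gr := ENNReal.toReal_nonneg
  have hGE : gagE N s p u = ENNReal.ofReal Gr := by
    rw [hGr, gagP, ENNReal.ofReal_toReal hug.ne]
  set e : ℝ := (N : ℝ) / (N - s * p) with he
  have hepos : 0 < e := by positivity
  -- truncations
  have htr : ∀ k : ℕ, ∫⁻ x, ENNReal.ofReal ((min |u x| k) ^ q) ≤ ENNReal.ofReal ((K * Gr) ^ e) := by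
    intro k
    set v : RN N → ℝ := fun x => min |u x| k with hv
    have hv0 : ∀ x, 0 ≤ v x := fun x => le_min (abs_nonneg _) (Nat.cast_nonneg _)
    have hvm : AEStronglyMeasurable v volume := 
      (hum.aemeasurable.abs.min aemeasurable_const).aestronglyMeasurable
    have hfin : ∫⁻ x, ENNReal.ofReal (v x ^ q) < ⊤ := by
      have hi : Integrable (fun x => (k:ℝ) ^ (q - p) * |u x| ^ p) volume := hup.const_mul _
      refine lt_of_le_of_lt (lintegral_mono fun x => ENNReal.ofReal_le_ofReal ?_) hi.lintegral_lt_top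
      rcases (hv0 x).eq_or_lt with h | h
      · rw [← h, Real.zero_rpow hq0.ne']; positivity
      · have : v x ^ q = v x ^ (q - p) * v x ^ p := by
          rw [← Real.rpow_add h]; ring_nf
        rw [this]
        exact mul_le_mul (Real.rpow_le_rpow (hv0 x) (min_le_right _ _) (by linarith))
          (Real.rpow_le_rpow (hv0 x) (min_le_left _ _) (by linarith)) (by positivity) (by positivity)
    change ∫⁻ x, ENNReal.ofReal (v x ^ q) ≤ _
    set A := (∫⁻ x, ENNReal.ofReal (v x ^ q)).toReal with hA
    have hAE : ∫⁻ x, ENNReal.ofReal (v x ^ q) = ENNReal.ofReal A := by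
      rw [hA, ENNReal.ofReal_toReal hfin.ne]
    rw [hAE]
    apply ENNReal.ofReal_le_ofReal
    have hA0 : 0 ≤ A := ENNReal.toReal_nonneg
    rcases hA0.eq_or_lt with h | hApos
    · rw [← h]; positivity
    have h1 : ENNReal.ofReal A ≤ ENNReal.ofReal (K * A ^ (s * p / N)) * ENNReal.ofReal Gr := by
      rw [← hAE, ← hGE, gagE, ← lintegral_const_mul' _ _ ENNReal.ofReal_ne_top]
      refine lintegral_mono fun x => (hpt v A hvm hv0 hApos hAE.le x).trans ?_
      refine mul_le_mul_right (lintegral_mono fun y => ENNReal.ofReal_le_ofReal ?_) _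
      refine div_le_div_of_nonneg_right (Real.rpow_le_rpow (abs_nonneg _) ?_ (by linarith))
        (by positivity)
      simp only [hv]
      have := abs_min_sub_min_le_max |u x| k |u y| k
      simp only [sub_self, abs_zero] at this
      refine this.trans ?_
      rw [max_eq_left (abs_nonneg _)]
      exact abs_abs_sub_abs_le _ _
    rw [← ENNReal.ofReal_mul (by positivity)] at h1
    have h2 := (ENNReal.ofReal_le_ofReal_iff (by positivity)).1 h1
    have h3 : A ^ (1 - s * p / N) ≤ K * Gr := by
      rw [Real.rpow_sub hApos, Real.rpow_one, div_le_iff₀ (by positivity)]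
      linarith
    calc A = (A ^ (1 - s * p / N)) ^ e := by
          rw [← Real.rpow_mul hA0, he]
          have : (1 - s * p / N) * (N / (N - s * p)) = 1 := by field_simp
          rw [this, Real.rpow_one]
      _ ≤ _ := Real.rpow_le_rpow (by positivity) h3 hepos.le
  have hlim : ∫⁻ x, ENNReal.ofReal (|u x| ^ q) ≤ ENNReal.ofReal ((K * Gr) ^ e) := by
    have ht := lintegral_tendsto_of_tendsto_of_monotone (μ := (volume : Measure (RN N)))
      (f := fun (k : ℕ) x => ENNReal.ofReal ((min |u x| k) ^ q))
      (F := fun x => ENNReal.ofReal (|u x| ^ q))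
      (fun k => ((hum.aemeasurable.abs.min aemeasurable_const).pow_const q).ennreal_ofReal)
      (Eventually.of_forall fun x i j hij => by
        apply ENNReal.ofReal_le_ofReal
        apply Real.rpow_le_rpow (le_min (abs_nonneg _) (Nat.cast_nonneg _)) _ hq0.le
        exact min_le_min_left _ (by exact_mod_cast hij))
      (Eventually.of_forall fun x => by
        apply tendsto_const_nhds.congr'
        filter_upwards [eventually_ge_atTop ⌈|u x|⌉₊] with k hk
        rw [min_eq_left]
        exact (Nat.le_ceil _).trans (by exact_mod_cast hk))
    exact le_of_tendsto' ht htr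
  have hint : Integrable (fun x => |u x| ^ q) volume := by
    refine ⟨(hum.aemeasurable.abs.pow_const q).aestronglyMeasurable, ?_⟩
    rw [hasFiniteIntegral_iff_ofReal (Eventually.of_forall fun x => by positivity)]
    exact hlim.trans_lt ENNReal.ofReal_lt_top
  refine ⟨hint, ?_⟩
  rw [← ofReal_integral_eq_lintegral_ofReal hint (Eventually.of_forall fun x => by positivity)]
    at hlim
  exact (ENNReal.ofReal_le_ofReal_iff (by positivity)).1 hlim

lemma aux_abs_pow (p a : ℝ) (hp : 2 ≤ p) : |a| ^ (p - 2) * a * a = |a| ^ p := by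
  rcases eq_or_ne a 0 with rfl | h
  · rw [abs_zero, Real.zero_rpow (show p ≠ 0 by linarith)]; simp
  · have h' : 0 < |a| := abs_pos.2 h
    rw [mul_assoc, ← abs_mul_abs_self a, ← pow_two, ← Real.rpow_natCast, ← Real.rpow_add h']
    norm_num

lemma aux_pair (N : ℕ) (s p : ℝ) (hp : 2 ≤ p) (u : RN N → ℝ) (hu : memW N s p u) :
    pairA N s p u u = gagP N s p u := by
  obtain ⟨hum, -, hug⟩ := hu
  have hm := aux_gag_meas N s p u hum
  have hm2 : AEMeasurable (fun x => ∫⁻ y, 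
      ENNReal.ofReal (|u x - u y| ^ p / ‖x - y‖ ^ ((N : ℝ) + s * p))) volume :=
    hm.lintegral_prod_right'
  rw [gagP, gagE, ← integral_toReal hm2 (ae_lt_top' hm2 hug.ne), pairA]
  apply integral_congr_ae
  refine Eventually.of_forall fun x => ?_
  simp only [aux_abs_pow p _ hp]
  rw [integral_eq_lintegral_of_nonneg_ae]
  · exact Eventually.of_forall fun y => by dsimp only [Pi.zero_apply]; positivity
  · apply AEMeasurable.aestronglyMeasurable
    apply AEMeasurable.div
    · exact ((hum.aemeasurable.const_sub (u x)).abs).pow_const p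
    · exact (by fun_prop : Measurable fun y : RN N => ‖x - y‖ ^ ((N : ℝ) + s * p)).aemeasurable

lemma aux_scale (N : ℕ) (s p c : ℝ) (hp : 2 ≤ p) (hc : 0 ≤ c) (u : RN N → ℝ)
    (hu : memW N s p u) : memW N s p (fun x => c * u x) ∧
      sobNormP N s p (fun x => c * u x) = c ^ p * sobNormP N s p u := by
  obtain ⟨hum, hup, hug⟩ := hu
  have hg : gagE N s p (fun x => c * u x) = ENNReal.ofReal (c ^ p) * gagE N s p u := by
    rw [gagE, gagE, ← lintegral_const_mul' _ _ ENNReal.ofReal_ne_top]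
    congr 1; ext x
    rw [← lintegral_const_mul' _ _ ENNReal.ofReal_ne_top]
    congr 1; ext y
    rw [← ENNReal.ofReal_mul (by positivity), ← mul_sub, abs_mul, abs_of_nonneg hc,
      Real.mul_rpow hc (abs_nonneg _), mul_div_assoc]
  have hi : (fun x => |c * u x| ^ p) = fun x => c ^ p * |u x| ^ p := by
    ext x
    rw [abs_mul, abs_of_nonneg hc, Real.mul_rpow hc (abs_nonneg _)]
  refine ⟨⟨hum.const_mul c, ?_, ?_⟩, ?_⟩
  · rw [hi]; exact hup.const_mul _
  · rw [hg]; exact ENNReal.mul_lt_top ENNReal.ofReal_lt_top hug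
  · rw [sobNormP, sobNormP, gagP, gagP, hg, hi, integral_const_mul, ENNReal.toReal_mul,
      ENNReal.toReal_ofReal (by positivity)]
    ring

lemma aux_growth (N : ℕ) (s p q : ℝ) (f : ℝ → ℝ) (hp : 2 ≤ p) (hpq : p < q)
    (hq : q = p * N / ((N : ℝ) - s * p))
    (hfc : Continuous f) (hf0 : ∀ t ≤ (0:ℝ), f t = 0)
    (hf1 : hypF1 p f) (hf2 : hypF2 N s p f) :
    ∃ C : ℝ, 0 < C ∧ ∀ t : ℝ, f t * t ≤ 1 / 2 * |t| ^ p + C * |t| ^ q := by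
  -- near zero
  have h1 : ∃ δ > (0:ℝ), ∀ t, 0 < t → t < δ → f t * t ≤ 1 / 2 * t ^ p := by
    have h := hf1.eventually_lt_const (show (0:ℝ) < 1 / 2 by norm_num)
    rw [eventually_nhdsWithin_iff, Metric.eventually_nhds_iff] at h
    obtain ⟨δ, hδ, h⟩ := h
    refine ⟨δ, hδ, fun t ht htδ => ?_⟩
    have h2 := h (y := t) (by rw [Real.dist_eq, sub_zero, abs_of_pos ht]; exact htδ) ht.ne'
    rw [div_lt_iff₀ (by positivity)] at h2
    have h3 := mul_le_mul_of_nonneg_right h2.le ht.le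
    have h4 := aux_abs_pow p t hp
    rw [mul_assoc, h4, abs_of_pos ht] at h3
    exact h3
  obtain ⟨δ, hδ, h1⟩ := h1
  have h2 : ∃ T > δ, ∀ t ≥ T, f t * t ≤ 2 * t ^ q := by
    unfold hypF2 at hf2
    rw [← hq] at hf2
    have h := eventually_lt_of_limsup_lt
      (hf2.trans_lt (show (1 : EReal) < ((2:ℝ) : EReal) by exact_mod_cast (by norm_num : (1:ℝ) < 2)))
    obtain ⟨T, hT⟩ := (h.and (eventually_gt_atTop δ)).exists_forall_of_atTop
    refine ⟨max T (δ + 1), lt_of_lt_of_le (by linarith) (le_max_right _ _), fun t ht => ?_⟩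
    obtain ⟨h3, h4⟩ := hT t (le_trans (le_max_left _ _) ht)
    have htp : 0 < t := hδ.trans h4
    have h5 : f t / t ^ (q - 1) < 2 := by exact_mod_cast h3
    rw [div_lt_iff₀ (by positivity)] at h5
    have h6 := mul_le_mul_of_nonneg_right h5.le htp.le
    have : t ^ (q - 1) * t = t ^ q := by
      rw [← Real.rpow_add_one htp.ne']; ring_nf
    rwa [mul_assoc, this] at h6
  obtain ⟨T, hT, h2⟩ := h2
  obtain ⟨B, hB⟩ := (isCompact_Icc (a := δ) (b := T)).exists_bound_of_continuousOn
    (f := fun t => f t * t) (by fun_prop)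
  have hB0 : 0 ≤ B := (norm_nonneg _).trans (hB δ ⟨le_rfl, hT.le⟩)
  have hδq : 0 < δ ^ q := by positivity
  refine ⟨2 + B / δ ^ q, by positivity, fun t => ?_⟩
  rcases le_or_gt t 0 with ht | ht
  · rw [hf0 t ht]; rw [zero_mul]; positivity
  rw [abs_of_pos ht]
  have htp : 0 < t ^ p := by positivity
  have htq : 0 < t ^ q := by positivity
  have hx : 0 ≤ B / δ ^ q * t ^ q := by positivity
  rcases lt_or_ge t δ with h | h
  · have := h1 t ht h
    nlinarith
  · rcases lt_or_ge t T with h' | h'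
    · have := (le_abs_self _).trans (hB t ⟨h, h'.le⟩)
      have h5 : δ ^ q ≤ t ^ q := Real.rpow_le_rpow hδ.le h (by linarith)
      have h6 : B ≤ B / δ ^ q * t ^ q := by
        rw [div_mul_eq_mul_div, le_div_iff₀ hδq]
        exact mul_le_mul_of_nonneg_left h5 hB0
      nlinarith
    · have := h2 t h'
      nlinarith

theorem lagrange_multipliers_bounded (N : ℕ) (s p : ℝ) (f : ℝ → ℝ)
    (hN : 2 ≤ N) (hs : s ∈ Set.Ioo (0:ℝ) 1) (hp : 2 ≤ p) (u : ℕ → RN N → ℝ) (lam : ℕ → ℝ)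
    (hsp : s * p < N)
    (hfc : Continuous f) (hf0 : ∀ t ≤ (0:ℝ), f t = 0)
    (hf1 : hypF1 p f) (hf2 : hypF2 N s p f)
    (hf3gs : ∃ q μ : ℝ, p < q ∧ q < p * N / ((N : ℝ) - s * p) ∧
      muStarSub N s p q < μ ∧ ∀ t ≥ (0:ℝ), μ * t ^ (q - 1) ≤ f t)
    (hf5 : hypF5 p f)
    (hM : ∀ n : ℕ, u n ∈ Mset N s p f)
    (hT : Tendsto (fun n => (1 / p) * gagP N s p (u n)) atTop (𝓝 (Dconst N s p f)))
    (hTJ : ∀ δ > (0:ℝ), ∀ᶠ n in atTop, ∀ φ : RN N → ℝ, memW N s p φ →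
      sobNorm N s p φ ≤ 1 →
        |pairA N s p (u n) φ - lam n * Jprime N s p f (u n) φ| ≤ δ) :
    (0 : EReal) ≤ Filter.liminf (fun n => ((lam n : ℝ) : EReal)) atTop ∧
      Filter.limsup (fun n => ((lam n : ℝ) : EReal)) atTop ≤ ((Dconst N s p f : ℝ) : EReal) := by
  obtain ⟨hs0, hs1⟩ := hs
  have hp0 : 0 < p := by linarith
  have hNpos : (0:ℝ) < N := by positivity
  have hspp : 0 < s * p := by positivity
  have hd : 0 < (N : ℝ) - s * p := by linarith
  obtain ⟨q, hqd⟩ : ∃ q, q = p * N / ((N : ℝ) - s * p) := ⟨_, rfl⟩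
  have hq : q * (N - s * p) = p * N := by rw [hqd, div_mul_cancel₀ _ hd.ne']
  have hpq : p < q := by
    rw [hqd, lt_div_iff₀ hd]
    nlinarith [mul_pos hspp hp0]
  obtain ⟨K, hK, hsob⟩ := aux_sob N hN s p q hs0 hp hsp hq
  obtain ⟨C, hC, hgr⟩ := aux_growth N s p q f hp hpq hqd hfc hf0 hf1 hf2
  have hF0 : ∀ t ≤ (0:ℝ), primF f t = 0 := by
    intro t ht
    rw [primF, intervalIntegral.integral_congr (g := fun _ => 0)]
    · simp
    · intro x hx
      rw [uIcc_of_ge ht] at hx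
      exact hf0 x hx.2
  have hfF : ∀ t, p * primF f t ≤ f t * t := by
    intro t
    rcases le_or_gt t 0 with ht | ht
    · rw [hF0 t ht, hf0 t ht]; simp
    · linarith [hf5.1 t ht]
  -- key facts for each n
  have key : ∀ n, p ≤ Jprime N s p f (u n) (u n) ∧
      (∫ x, |u n x| ^ p) ≤ 2 * C * (K * gagP N s p (u n)) ^ ((N : ℝ) / (N - s * p)) := by
    intro n
    obtain ⟨hW, -, hG1⟩ := hM n
    obtain ⟨hqi, hqb⟩ := hsob (u n) hW
    have hpi := hW.2.1
    have hGi : Integrable (fun x => Gfun p f (u n x)) volume := by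
      by_contra h
      rw [integral_undef h] at hG1
      norm_num at hG1
    have hdom : Integrable (fun x => 1 / 2 * |u n x| ^ p + C * |u n x| ^ q) volume :=
      (hpi.const_mul _).add (hqi.const_mul _)
    have hfi : Integrable (fun x => f (u n x) * u n x) volume := by
      refine hdom.mono' ((hfc.comp_aestronglyMeasurable hW.1).mul hW.1)
        (Eventually.of_forall fun x => ?_)
      have h0 : 0 ≤ f (u n x) * u n x :=
        le_trans (mul_nonneg hp0.le (hf5.2 _)) (hfF (u n x))
      rw [Real.norm_eq_abs, abs_of_nonneg h0]
      exact hgr _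
    have hJ : p ≤ (∫ x, f (u n x) * u n x) - ∫ x, |u n x| ^ p := by
      rw [← integral_sub hfi hpi]
      calc p = ∫ x, p * Gfun p f (u n x) := by rw [integral_const_mul, hG1, mul_one]
        _ ≤ _ := by
          refine integral_mono (hGi.const_mul p) (hfi.sub hpi) fun x => ?_
          have := hfF (u n x)
          have e : p * Gfun p f (u n x) = p * primF f (u n x) - |u n x| ^ p := by
            rw [Gfun]; field_simp
          dsimp only
          rw [e]
          linarith
    constructor
    · rw [Jprime]
      have : (fun x => (f (u n x) - |u n x| ^ (p - 2) * u n x) * u n x) =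
          fun x => f (u n x) * u n x - |u n x| ^ p := by
        ext x
        rw [sub_mul, aux_abs_pow p _ hp]
      rw [this, integral_sub hfi hpi]
      exact hJ
    · have h1 : (∫ x, f (u n x) * u n x) ≤ 1 / 2 * (∫ x, |u n x| ^ p) + C * ∫ x, |u n x| ^ q := by
        rw [← integral_const_mul, ← integral_const_mul,
          ← integral_add (hpi.const_mul _) (hqi.const_mul _)]
        exact integral_mono hfi hdom fun x => hgr _
      have h2 := mul_le_mul_of_nonneg_left hqb hC.le
      linarith
  set D := Dconst N s p f with hD
  -- bound on the norms
  obtain ⟨R, hR1, hR⟩ : ∃ R : ℝ, 1 ≤ R ∧ ∀ᶠ n in atTop, sobNormP N s p (u n) ≤ R ^ p := by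
    set P := p * (D + 1) with hP
    set R0 := |P + 2 * C * (K * P) ^ ((N : ℝ) / (N - s * p))| + 1 with hR0
    have hR01 : 1 ≤ R0 := by rw [hR0]; linarith [abs_nonneg (P + 2 * C * (K * P) ^ ((N : ℝ) / (N - s * p)))]
    refine ⟨R0, hR01, ?_⟩
    filter_upwards [hT.eventually_le_const (show D < D + 1 by linarith)] with n hn
    have h0 : 0 ≤ gagP N s p (u n) := ENNReal.toReal_nonneg
    have hg : gagP N s p (u n) ≤ P := by
      rw [one_div, inv_mul_le_iff₀ hp0] at hn
      exact hn
    have h3 : (K * gagP N s p (u n)) ^ ((N : ℝ) / (N - s * p)) ≤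
        (K * P) ^ ((N : ℝ) / (N - s * p)) :=
      Real.rpow_le_rpow (by positivity) (mul_le_mul_of_nonneg_left hg hK.le) (by positivity)
    have h4 := mul_le_mul_of_nonneg_left h3 (by positivity : 0 ≤ 2 * C)
    have h5 : R0 ≤ R0 ^ p := by
      conv_lhs => rw [← Real.rpow_one R0]
      exact Real.rpow_le_rpow_of_exponent_le hR01 (by linarith)
    have h6 := le_abs_self (P + 2 * C * (K * P) ^ ((N : ℝ) / (N - s * p)))
    rw [sobNormP]
    linarith [(key n).2]
  have hRpos : 0 < R := by linarith
  have main : ∀ δ > (0:ℝ), ∀ᶠ n in atTop,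
      |gagP N s p (u n) - lam n * Jprime N s p f (u n) (u n)| ≤ δ := by
    intro δ hδ
    filter_upwards [hTJ (δ / R) (by positivity), hR] with n hn hRn
    have hW := (hM n).1
    obtain ⟨hm, hsc⟩ := aux_scale N s p R⁻¹ hp (by positivity) (u n) hW
    have h1 := hn _ hm (by
      rw [sobNorm, hsc]
      apply Real.rpow_le_one
      · have : 0 ≤ sobNormP N s p (u n) :=
          add_nonneg ENNReal.toReal_nonneg (integral_nonneg fun x => by positivity)
        positivity
      · rw [Real.inv_rpow hRpos.le, inv_mul_le_iff₀ (by positivity), mul_one]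
        exact hRn
      · positivity)
    have e1 : pairA N s p (u n) (fun x => R⁻¹ * u n x) = R⁻¹ * pairA N s p (u n) (u n) := by
      rw [pairA, pairA, ← integral_const_mul]
      congr 1; ext x
      rw [← integral_const_mul]
      congr 1; ext y
      ring
    have e2 : Jprime N s p f (u n) (fun x => R⁻¹ * u n x) =
        R⁻¹ * Jprime N s p f (u n) (u n) := by
      rw [Jprime, Jprime, ← integral_const_mul]
      congr 1; ext x
      ring
    rw [e1, e2, aux_pair N s p hp (u n) hW] at h1
    have e3 : R⁻¹ * gagP N s p (u n) - lam n * (R⁻¹ * Jprime N s p f (u n) (u n)) =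
        R⁻¹ * (gagP N s p (u n) - lam n * Jprime N s p f (u n) (u n)) := by ring
    rw [e3, abs_mul, abs_of_pos (by positivity), inv_mul_le_iff₀ hRpos,
      mul_div_cancel₀ _ hRpos.ne'] at h1
    exact h1
  constructor
  · apply EReal.ge_of_forall_gt_iff_ge.1
    intro z hz
    have hz' : z < 0 := by exact_mod_cast hz
    apply le_liminf_of_le
    · isBoundedDefault
    filter_upwards [main (p * (-z)) (by nlinarith)] with n hn
    have h1 := (abs_le.1 hn).2
    have h0 : 0 ≤ gagP N s p (u n) := ENNReal.toReal_nonneg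
    have hJ := (key n).1
    have : z ≤ lam n := by
      by_contra h
      push Not at h
      nlinarith
    exact_mod_cast this
  · apply EReal.le_of_forall_lt_iff_le.1
    intro z hz
    have hz' : D < z := by exact_mod_cast hz
    apply limsup_le_of_le
    · isBoundedDefault
    have hz2 : D < (D + z) / 2 := by linarith
    filter_upwards [main (p * ((z - D) / 2)) (by nlinarith),
      hT.eventually_le_const hz2] with n hn hn2
    have h1 := (abs_le.1 hn).1
    have h0 : 0 ≤ gagP N s p (u n) := ENNReal.toReal_nonneg
    have hJ := (key n).1
    rw [one_div, inv_mul_le_iff₀ hp0] at hn2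
    have : lam n ≤ z := by
      by_contra h
      push Not at h
      have h5 : lam n * Jprime N s p f (u n) (u n) ≤ p * z := by nlinarith
      have hz0 : 0 ≤ z := by
        have : 0 ≤ p * ((D + z) / 2) := h0.trans hn2
        have := nonneg_of_mul_nonneg_right this hp0
        linarith
      have : p * z < lam n * Jprime N s p f (u n) (u n) := by
        nlinarith
      linarith
    exact_mod_cast this
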